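/- arXiv:1902.10730 — 3 statements merged into one kernel-verified Lean document; each statement's English description precedes it below -/
import Mathlib

section
/- Assume F is continuous at the point (μ, 0) for every μ ∈ ℝ, F(μ, 0) < 1 for all μ ≥ 0, and F(μ, 0) > 0 for all μ ≤ 0. Then for every B > 0 there exists ε > 0 (depending only on B) such that 1 − F(μ, ε) ≥ ε for all μ ∈ [0, B] and F(μ, −ε) ≥ ε for all μ ∈ [−B, 0]. -/
open MeasureTheory Filter ProbabilityTheory

/-- The uniform distribution `U([0,1])` on the reals. -/
noncomputable def unif : Measure ℝ := volume.restrict (Set.Icc 0 1)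

/-- The cumulative distribution function of the increment:
`F f μ x = P_{ξ ∼ U([0,1])} (f μ ξ ≤ x)`. -/
noncomputable def incCDF (f : ℝ → ℝ → ℝ) (m x : ℝ) : ℝ :=
  (unif {ξ | f m ξ ≤ x}).toReal

/-- A function that is continuous and positive along `K ×ˢ {0}`, with `K` compact, satisfies
`x < G (k, x)` for all `k ∈ K` as soon as `x` is close enough to `0`. -/
theorem IsCompact.eventually_forall_lt_of_continuousAt_of_pos {X : Type*} [TopologicalSpace X]
    {K : Set X} (hK : IsCompact K) {G : X × ℝ → ℝ} (hG : ∀ k ∈ K, ContinuousAt G (k, 0))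
    (hpos : ∀ k ∈ K, 0 < G (k, 0)) :
    ∀ᶠ x in nhds (0 : ℝ), ∀ k ∈ K, x < G (k, x) := by
  refine hK.eventually_forall_of_forall_eventually fun k hk => ?_
  have hcont : ContinuousAt (fun z : ℝ × X => G (z.2, z.1)) (0, k) :=
    ContinuousAt.comp (f := Prod.swap) (hG k hk) continuous_swap.continuousAt
  exact continuousAt_fst.eventually_lt hcont (hpos k hk)

/-- If `F` is continuous at `(μ, 0)` for all `μ`, `F (μ, 0) < 1` for all `μ ≥ 0` and
`F (μ, 0) > 0` for all `μ ≤ 0`, then for every `B > 0` there is `ε > 0` such that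
`1 - F (μ, ε) ≥ ε` on `[0, B]` and `F (μ, -ε) ≥ ε` on `[-B, 0]`. -/
theorem uniform_escape_probability
    (f : ℝ → ℝ → ℝ) (hf : Measurable (Function.uncurry f))
    (hFcont : ∀ m : ℝ, ContinuousAt (fun p : ℝ × ℝ => incCDF f p.1 p.2) (m, 0))
    (h1 : ∀ m : ℝ, 0 ≤ m → incCDF f m 0 < 1)
    (h2 : ∀ m : ℝ, m ≤ 0 → 0 < incCDF f m 0) :
    ∀ B : ℝ, 0 < B → ∃ ε : ℝ, 0 < ε ∧
      (∀ m ∈ Set.Icc (0 : ℝ) B, ε ≤ 1 - incCDF f m ε) ∧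
      (∀ m ∈ Set.Icc (-B) (0 : ℝ), ε ≤ incCDF f m (-ε)) := by
  intro B _
  have hup := (isCompact_Icc (a := (0 : ℝ)) (b := B)).eventually_forall_lt_of_continuousAt_of_pos
    (G := fun p => 1 - incCDF f p.1 p.2)
    (fun m _ => continuousAt_const.sub (hFcont m)) (fun m hm => sub_pos.2 (h1 m hm.1))
  have hdown := (isCompact_Icc (a := -B) (b := (0 : ℝ))).eventually_forall_lt_of_continuousAt_of_pos
    (G := fun p => incCDF f p.1 (-p.2))
    (fun m _ => ContinuousAt.comp_of_eq (f := fun p : ℝ × ℝ => (p.1, -p.2)) (hFcont m)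
      (by fun_prop) (by simp))
    (fun m hm => by simpa using h2 m hm.2)
  obtain ⟨ε, ⟨hu, hd⟩, hε⟩ := (((hup.and hdown).filter_mono nhdsWithin_le_nhds).and
    (self_mem_nhdsWithin (s := Set.Ioi (0 : ℝ)))).exists
  exact ⟨ε, hε, fun m hm => (hu m hm).le, fun m hm => (hd m hm).le⟩
end

section
/- Let (μ_t) and (d_t) be real sequences such that: (i) for every t, μ_t > d_t if and only if μ_{t+1} > μ_t; and (ii) there exists t_0 ≥ 0 such that |d_{t+1} − d_t| ≤ |μ_{t+1} − μ_t| for all t ≥ t_0. If μ_{t_0} > d_{t_0}, then μ_t > d_t for all t ≥ t_0, and consequently the sequence (μ_t)_{t ≥ t_0} is strictly increasing. -/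
open Filter

/-- If the interest `μ_t` increases exactly when it exceeds the threshold `d_t`, and
from time `t₀` on the threshold moves by at most as much as the interest, then
`μ_{t₀} > d_{t₀}` implies `μ_t > d_t` for all `t ≥ t₀`, and `μ` is strictly
increasing on `[t₀, ∞)`. -/
theorem threshold_dynamics_above (μ d : ℕ → ℝ) (t₀ : ℕ)
    (h1 : ∀ t, μ t > d t ↔ μ (t + 1) > μ t)
    (h2 : ∀ t ≥ t₀, |d (t + 1) - d t| ≤ |μ (t + 1) - μ t|)
    (h0 : μ t₀ > d t₀) :
    (∀ t ≥ t₀, μ t > d t) ∧ StrictMonoOn μ (Set.Ici t₀) := by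
  have above : ∀ t ≥ t₀, μ t > d t := by
    intro t ht
    induction t, ht using Nat.le_induction with
    | base => exact h0
    | succ t ht ih =>
      have hinc := (h1 t).1 ih
      have hstep := h2 t ht
      rw [abs_of_pos (sub_pos.2 hinc)] at hstep
      linarith [le_abs_self (d (t + 1) - d t)]
  refine ⟨above, fun a ha b _ hab => ?_⟩
  induction b, Nat.succ_le_of_lt hab using Nat.le_induction with
  | base => exact (h1 a).1 (above a ha)
  | succ b hb ih =>
    have hab' : a < b := hb
    have hb' : t₀ ≤ b := le_trans ha hab'.le
    exact (ih hb' hab').trans ((h1 b).1 (above b hb'))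
end

section
/- Let (μ_t) and (d_t) be real sequences such that: (i) for every t, μ_t > d_t if and only if μ_{t+1} > μ_t; and (ii) there exists t_0 ≥ 0 such that |d_{t+1} − d_t| ≤ |μ_{t+1} − μ_t| for all t ≥ t_0. If μ_{t_0} ≤ d_{t_0}, then μ_t ≤ d_t for all t ≥ t_0, and consequently the sequence (μ_t)_{t ≥ t_0} is nonincreasing. -/
open Filter

/-- If the interest `μ_t` increases exactly when it exceeds the threshold `d_t`, and
from time `t₀` on the threshold moves by at most as much as the interest, then
`μ_{t₀} ≤ d_{t₀}` implies `μ_t ≤ d_t` for all `t ≥ t₀`, and `μ` is nonincreasing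
on `[t₀, ∞)`. -/
theorem threshold_dynamics_below (μ d : ℕ → ℝ) (t₀ : ℕ)
    (h1 : ∀ t, μ t > d t ↔ μ (t + 1) > μ t)
    (h2 : ∀ t ≥ t₀, |d (t + 1) - d t| ≤ |μ (t + 1) - μ t|)
    (h0 : μ t₀ ≤ d t₀) :
    (∀ t ≥ t₀, μ t ≤ d t) ∧ AntitoneOn μ (Set.Ici t₀) := by
  have step : ∀ t, μ t ≤ d t → μ (t + 1) ≤ μ t := fun t ht =>
    not_lt.1 fun h => ht.not_gt ((h1 t).2 h)
  have below : ∀ t ≥ t₀, μ t ≤ d t := by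
    intro t ht
    induction t, ht using Nat.le_induction with
    | base => exact h0
    | succ t ht ih =>
      have hd := h2 t ht
      rw [abs_of_nonpos (sub_nonpos.2 (step t ih))] at hd
      linarith [(abs_le.1 hd).1]
  refine ⟨below, fun s hs t _ hst => ?_⟩
  induction t, hst using Nat.le_induction with
  | base => exact le_rfl
  | succ t hst ih =>
    have ht : t₀ ≤ t := le_trans hs hst
    exact (step t (below t ht)).trans (ih ht)
end
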